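/- arXiv:2601.06745 — 2 statements merged into one kernel-verified Lean document; each statement's English description precedes it below -/
import Mathlib

section
/- Let N ≥ 2 and let M₁,…,M_N be closed proper subspaces of а complex Hilbert space H, with M = ⋂_{i=1}^N M_i. Then the following assertions are equivalent: (1) 1 ∉ σ(P_{M₁}P_{M₂}⋯P_{M_N} − P_M); (2) ‖P_{M₁}P_{M₂}⋯P_{M_N} − P_M‖ < 1; (3) ‖(1/N)∑_{i=1}^N P_{M_i} − P_M‖ < 1. -/
set_option linter.unusedSectionVars false

variable {H : Type*} [NormedAddCommGroup H] [InnerProductSpace ℂ H] [CompleteSpace H]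

/-- The orthogonal projection onto a closed subspace, as an operator on the ambient space. -/
noncomputable def proj (S : Submodule ℂ H) (hS : IsClosed (S : Set H)) : H →L[ℂ] H :=
  haveI : CompleteSpace S := hS.completeSpace_coe
  S.subtypeL.comp (Submodule.orthogonalProjectionOnto S)

lemma isClosed_iInf {ι : Sort*} {S : ι → Submodule ℂ H} (h : ∀ i, IsClosed ((S i : Set H))) :
    IsClosed ((⨅ i, S i : Submodule ℂ H) : Set H) := by
  rw [Submodule.coe_iInf]
  exact isClosed_iInter h

structure PL (P : H →L[ℂ] H) : Prop where
  pyth : ∀ x, ‖P x‖ ^ 2 + ‖x - P x‖ ^ 2 = ‖x‖ ^ 2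
  min : ∀ x z, ‖x - P x‖ ≤ ‖x - P z‖

lemma PL.contr {P : H →L[ℂ] H} (h : PL P) (x : H) : ‖P x‖ ≤ ‖x‖ := by
  have := h.pyth x
  refine (sq_le_sq₀ (norm_nonneg _) (norm_nonneg _)).1 (by nlinarith [sq_nonneg ‖x - P x‖])

lemma proj_PL (S : Submodule ℂ H) (hS : IsClosed (S : Set H)) : PL (proj S hS) := by
  haveI : CompleteSpace S := hS.completeSpace_coe
  have hm : ∀ z, proj S hS z ∈ S := fun z => (S.orthogonalProjectionOnto z).2
  have ho : ∀ x, ∀ w ∈ S, inner ℂ (x - proj S hS x) w = 0 := by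
    intro x w hw
    exact Submodule.starProjection_inner_eq_zero x w hw
  have key : ∀ x, ∀ w ∈ S, ‖x - proj S hS x + w‖ ^ 2 = ‖x - proj S hS x‖ ^ 2 + ‖w‖ ^ 2 := by
    intro x w hw
    have := norm_add_sq_eq_norm_sq_add_norm_sq_of_inner_eq_zero _ _ (ho x w hw)
    nlinarith
  refine ⟨fun x => ?_, fun x z => ?_⟩
  · have := key x _ (hm x)
    rw [sub_add_cancel] at this
    linarith
  · have := key x _ (S.sub_mem (hm x) (hm z))
    rw [sub_add_sub_cancel] at this
    refine (sq_le_sq₀ (norm_nonneg _) (norm_nonneg _)).1 (by nlinarith [sq_nonneg ‖proj S hS x - proj S hS z‖])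

lemma proj_fix (S : Submodule ℂ H) (hS : IsClosed (S : Set H)) (x : H) (hx : x ∈ S) :
    proj S hS x = x := by
  haveI : CompleteSpace S := hS.completeSpace_coe
  exact Submodule.starProjection_eq_self_iff.2 hx

lemma proj_mem (S : Submodule ℂ H) (hS : IsClosed (S : Set H)) (x : H) :
    proj S hS x ∈ S := by
  haveI : CompleteSpace S := hS.completeSpace_coe
  exact (S.orthogonalProjectionOnto x).2

lemma list_fix (L : List (H →L[ℂ] H)) (x : H) (h : ∀ P ∈ L, P x = x) : L.prod x = x := by
  induction L with
  | nil => simp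
  | cons P L ih =>
    rw [List.prod_cons, ContinuousLinearMap.mul_apply, ih fun P hP => h P (by simp [hP])]
    exact h P (by simp)

lemma list_sub (L : List (H →L[ℂ] H)) (h : ∀ P ∈ L, PL P) (x : H) :
    ‖x - L.prod x‖ ≤ (L.map fun P => ‖x - P x‖).sum := by
  induction L with
  | nil => simp
  | cons P L ih =>
    rw [List.prod_cons, ContinuousLinearMap.mul_apply, List.map_cons, List.sum_cons]
    have h1 := ih fun P hP => h P (by simp [hP])
    have h2 := (h P (by simp)).contr (x - L.prod x)
    have h3 := norm_add_le (x - P x) (P (x - L.prod x))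
    rw [map_sub] at h2 h3
    rw [sub_add_sub_cancel] at h3
    linarith

lemma list_key (L : List (H →L[ℂ] H)) (h : ∀ P ∈ L, PL P) (x : H) :
    ‖L.prod x‖ ≤ ‖x‖ ∧ ‖x - L.prod x‖ ^ 2 ≤ 2 ^ L.length * (‖x‖ ^ 2 - ‖L.prod x‖ ^ 2) ∧
      ∀ P ∈ L, ‖x - P x‖ ^ 2 ≤ 2 ^ L.length * (‖x‖ ^ 2 - ‖L.prod x‖ ^ 2) := by
  induction L with
  | nil => simp
  | cons P L ih =>
    rw [List.prod_cons, ContinuousLinearMap.mul_apply, List.length_cons]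
    obtain ⟨h1, h2, h3⟩ := ih fun P hP => h P (by simp [hP])
    have hP := h P (by simp)
    set z := L.prod x
    have c := hP.contr z
    have p := hP.pyth z
    have k1 : (1 : ℝ) ≤ 2 ^ L.length := one_le_pow₀ (by norm_num)
    have d1 : 0 ≤ ‖x‖ ^ 2 - ‖z‖ ^ 2 := by nlinarith [norm_nonneg z]
    have e : ‖x - P z‖ ^ 2 ≤ 2 ^ (L.length + 1) * (‖x‖ ^ 2 - ‖P z‖ ^ 2) := by
      have t := norm_add_le (x - z) (z - P z)
      rw [sub_add_sub_cancel] at t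
      have t2 : ‖x - P z‖ ^ 2 ≤ 2 * ‖x - z‖ ^ 2 + 2 * ‖z - P z‖ ^ 2 := by
        nlinarith [sq_nonneg (‖x - z‖ - ‖z - P z‖), norm_nonneg (x - P z)]
      rw [pow_succ (2 : ℝ) L.length, show ‖P z‖ ^ 2 = ‖z‖ ^ 2 - ‖z - P z‖ ^ 2 by linarith]
      nlinarith [mul_nonneg (sub_nonneg.2 k1) (sq_nonneg ‖z - P z‖)]
    refine ⟨c.trans h1, e, ?_⟩
    intro R hR
    rcases List.mem_cons.1 hR with rfl | hR
    · exact le_trans (pow_le_pow_left₀ (norm_nonneg _) (hP.min x z) 2) e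
    · refine (h3 R hR).trans ?_
      rw [pow_succ (2 : ℝ) L.length]
      have : 0 ≤ ‖z‖ ^ 2 - ‖P z‖ ^ 2 := by nlinarith [sq_nonneg ‖z - P z‖]
      nlinarith [mul_nonneg (zero_le_one.trans k1) this, mul_nonneg (zero_le_one.trans k1) d1]

lemma norm_lt_aux (B Q T : H →L[ℂ] H) (hB : ∀ x, B x = T (x - Q x)) (hQ : PL Q) (K : ℝ)
    (hK : 0 < K) (h : ∀ x, ‖x - Q x‖ ^ 2 ≤ K * (‖x - Q x‖ ^ 2 - ‖T (x - Q x)‖ ^ 2)) :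
    ‖B‖ < 1 := by
  have hc : max (1 - 1 / K) 0 < 1 := by
    have := one_div_pos.2 hK
    exact max_lt (by linarith) one_pos
  refine lt_of_le_of_lt (B.opNorm_le_bound (Real.sqrt_nonneg (max (1 - 1 / K) 0)) fun x => ?_)
    (by rw [Real.sqrt_lt' one_pos]; simpa using hc)
  rw [hB]
  have h1 := h x
  have h2 : ‖x - Q x‖ ^ 2 ≤ ‖x‖ ^ 2 := by nlinarith [hQ.pyth x, sq_nonneg ‖Q x‖]
  have h3 : ‖T (x - Q x)‖ ^ 2 ≤ (1 - 1 / K) * ‖x - Q x‖ ^ 2 := by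
    have : ‖x - Q x‖ ^ 2 / K ≤ ‖x - Q x‖ ^ 2 - ‖T (x - Q x)‖ ^ 2 := by
      rw [div_le_iff₀ hK]; linarith
    have e : (1 - 1 / K) * ‖x - Q x‖ ^ 2 = ‖x - Q x‖ ^ 2 - ‖x - Q x‖ ^ 2 / K := by ring
    linarith
  have h4 : (1 - 1 / K) * ‖x - Q x‖ ^ 2 ≤ max (1 - 1 / K) 0 * ‖x‖ ^ 2 :=
    mul_le_mul (le_max_left _ _) h2 (sq_nonneg _) (le_max_right _ _)
  refine (sq_le_sq₀ (norm_nonneg _) (by positivity)).1 ?_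
  rw [mul_pow, Real.sq_sqrt (le_max_right _ _)]
  linarith

/-- (Badea–Grivaux–Müller) For closed proper subspaces `M₁, …, M_N` with
intersection `M`, the following are equivalent: `1 ∉ σ(P_{M₁}⋯P_{M_N} − P_M)`;
`‖P_{M₁}⋯P_{M_N} − P_M‖ < 1`; `‖N⁻¹ ∑ᵢ P_{Mᵢ} − P_M‖ < 1`. -/
theorem tfae_product_average_projections
    {N : ℕ} (hN : 2 ≤ N) (M : Fin N → Submodule ℂ H)
    (hMc : ∀ i, IsClosed ((M i : Set H))) (hMp : ∀ i, M i ≠ ⊤) :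
    List.TFAE
      [ (1 : ℂ) ∉ spectrum ℂ
          ((List.ofFn fun i => proj (M i) (hMc i)).prod - proj (⨅ i, M i) (isClosed_iInf hMc)),
        ‖(List.ofFn fun i => proj (M i) (hMc i)).prod - proj (⨅ i, M i) (isClosed_iInf hMc)‖ < 1,
        ‖((N : ℂ)⁻¹ • ∑ i, proj (M i) (hMc i)) - proj (⨅ i, M i) (isClosed_iInf hMc)‖ < 1 ] := by
  have hN0 : (0 : ℝ) < N := by exact_mod_cast (by omega : 0 < N)
  set Q := proj (⨅ i, M i) (isClosed_iInf hMc) with hQdef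
  set P : Fin N → (H →L[ℂ] H) := fun i => proj (M i) (hMc i) with hPdef
  set L := List.ofFn P with hL
  have hQ : PL Q := proj_PL _ _
  have hP : ∀ i, PL (P i) := fun i => proj_PL _ _
  have hLP : ∀ R ∈ L, PL R := by
    intro R hR
    obtain ⟨i, rfl⟩ := (List.mem_ofFn' _ _).1 hR
    exact hP i
  have hPQ : ∀ i x, P i (Q x) = Q x := fun i x =>
    proj_fix _ _ _ ((Submodule.mem_iInf _).1 (proj_mem _ (isClosed_iInf hMc) x) i)
  have hQQ : ∀ x, Q (Q x) = Q x := fun x => proj_fix _ _ _ (proj_mem _ _ _)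
  have hQ0 : ∀ x, Q (x - Q x) = 0 := fun x => by rw [map_sub, hQQ, sub_self]
  have hTQ : ∀ x, L.prod (Q x) = Q x := by
    intro x
    refine list_fix _ _ fun R hR => ?_
    obtain ⟨i, rfl⟩ := (List.mem_ofFn' _ _).1 hR
    exact hPQ i x
  set A : H →L[ℂ] H := (N : ℂ)⁻¹ • ∑ i, P i with hA
  have hNC : (N : ℂ) ≠ 0 := by exact_mod_cast (by omega : N ≠ 0)
  have hAx : ∀ x, A x = (N : ℂ)⁻¹ • ∑ i, P i x := fun x => by
    simp [hA, ContinuousLinearMap.sum_apply]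
  have hAQ : ∀ x, A (Q x) = Q x := by
    intro x
    rw [hAx]
    simp only [hPQ, Finset.sum_const, Finset.card_univ, Fintype.card_fin]
    rw [← Nat.cast_smul_eq_nsmul ℂ, smul_smul, inv_mul_cancel₀ hNC, one_smul]
  have hsq : (∃ C : ℝ, 0 < C ∧ ∀ y, Q y = 0 → ‖y‖ ≤ C * ∑ i, ‖y - P i y‖) →
      ∃ K : ℝ, 0 < K ∧ ∀ y, Q y = 0 → ‖y‖ ^ 2 ≤ K * ∑ i, ‖y - P i y‖ ^ 2 := by
    rintro ⟨C, hC, h⟩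
    refine ⟨C ^ 2 * N, by positivity, fun y hy => ?_⟩
    have h1 := pow_le_pow_left₀ (norm_nonneg _) (h y hy) 2
    have h2 := sq_sum_le_card_mul_sum_sq (s := Finset.univ) (f := fun i => ‖y - P i y‖)
    rw [Finset.card_univ, Fintype.card_fin] at h2
    rw [mul_pow] at h1
    refine h1.trans ?_
    rw [mul_assoc]
    gcongr
  have avg : (∃ K : ℝ, 0 < K ∧ ∀ y, Q y = 0 → ‖y‖ ^ 2 ≤ K * ∑ i, ‖y - P i y‖ ^ 2) →
      ‖A - Q‖ < 1 := by
    rintro ⟨K, hK, hE⟩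
    refine norm_lt_aux _ Q A (fun x => by simp [hAQ]) hQ (K * N) (by positivity) fun x => ?_
    refine (hE _ (hQ0 x)).trans ?_
    set y := x - Q x
    rw [mul_assoc]
    gcongr
    have h1 : ‖A y‖ ≤ (N : ℝ)⁻¹ * ∑ i, ‖P i y‖ := by
      rw [hAx, norm_smul, norm_inv, Complex.norm_natCast]
      gcongr
      exact norm_sum_le _ _
    have h2 := sq_sum_le_card_mul_sum_sq (s := Finset.univ) (f := fun i => ‖P i y‖)
    rw [Finset.card_univ, Fintype.card_fin] at h2
    have h3 : N * ‖A y‖ ≤ ∑ i, ‖P i y‖ := by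
      rw [← div_eq_inv_mul, le_div_iff₀ hN0] at h1; linarith
    have h4 := pow_le_pow_left₀ (by positivity) h3 2
    have h5 : N * ‖A y‖ ^ 2 ≤ ∑ i, ‖P i y‖ ^ 2 := by
      refine le_of_mul_le_mul_left ?_ hN0
      nlinarith
    have h6 : ∑ i, ‖P i y‖ ^ 2 + ∑ i, ‖y - P i y‖ ^ 2 = N * ‖y‖ ^ 2 := by
      rw [← Finset.sum_add_distrib, Finset.sum_congr rfl fun i _ => (hP i).pyth y]
      simp
    rw [mul_sub]
    linarith
  tfae_have 2 → 1 := by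
    intro h
    rw [spectrum.notMem_iff, map_one]
    exact isUnit_one_sub_of_norm_lt_one h
  tfae_have 1 → 3 := by
    intro h
    rw [spectrum.notMem_iff, map_one] at h
    obtain ⟨u, hu⟩ := h
    refine avg (hsq ⟨‖(↑u⁻¹ : H →L[ℂ] H)‖ + 1, by positivity, fun y hy => ?_⟩)
    have e : y = (↑u⁻¹ : H →L[ℂ] H) (y - L.prod y) := by
      have : (↑u⁻¹ * ↑u : H →L[ℂ] H) y = y := by rw [Units.inv_mul]; rfl
      rw [ContinuousLinearMap.mul_apply, hu] at this
      simpa [hy] using this.symm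
    have h1 := (↑u⁻¹ : H →L[ℂ] H).le_opNorm (y - L.prod y)
    rw [← e] at h1
    have h2 := list_sub L hLP y
    have h3 : (L.map fun P => ‖y - P y‖).sum = ∑ i, ‖y - P i y‖ := by
      rw [hL, List.map_ofFn, List.sum_ofFn]; rfl
    rw [h3] at h2
    refine h1.trans ?_
    gcongr
    linarith
  tfae_have 3 → 2 := by
    intro h
    have hE : ∃ C : ℝ, 0 < C ∧ ∀ y, Q y = 0 → ‖y‖ ≤ C * ∑ i, ‖y - P i y‖ := by
      refine ⟨(1 - ‖A - Q‖)⁻¹ * (N : ℝ)⁻¹, by have := sub_pos.2 h; positivity, fun y hy => ?_⟩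
      have h1 : ‖A y‖ ≤ ‖A - Q‖ * ‖y‖ := by
        have := (A - Q).le_opNorm y
        simpa [hy] using this
      have h2 : y - A y = (N : ℂ)⁻¹ • ∑ i, (y - P i y) := by
        rw [hAx, Finset.sum_sub_distrib, smul_sub]
        congr 1
        simp only [Finset.sum_const, Finset.card_univ, Fintype.card_fin]
        rw [← Nat.cast_smul_eq_nsmul ℂ, smul_smul, inv_mul_cancel₀ hNC, one_smul]
      have h3 : ‖y - A y‖ ≤ (N : ℝ)⁻¹ * ∑ i, ‖y - P i y‖ := by
        rw [h2, norm_smul, norm_inv, Complex.norm_natCast]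
        gcongr
        exact norm_sum_le _ _
      have h4 := norm_sub_norm_le y (A y)
      rw [mul_assoc, ← div_eq_inv_mul, le_div_iff₀ (sub_pos.2 h)]
      linarith
    obtain ⟨K, hK, hE⟩ := hsq hE
    refine norm_lt_aux _ Q L.prod (fun x => by simp [hTQ]) hQ (K * (N * 2 ^ L.length))
      (by positivity) fun x => ?_
    refine (hE _ (hQ0 x)).trans ?_
    set y := x - Q x
    rw [mul_assoc]
    gcongr
    have : ∀ i ∈ Finset.univ, ‖y - P i y‖ ^ 2 ≤ 2 ^ L.length * (‖y‖ ^ 2 - ‖L.prod y‖ ^ 2) :=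
      fun i _ => (list_key L hLP y).2.2 _ ((List.mem_ofFn' _ _).2 ⟨i, rfl⟩)
    refine (Finset.sum_le_card_nsmul _ _ _ this).trans (le_of_eq ?_)
    rw [Finset.card_univ, Fintype.card_fin, nsmul_eq_mul, mul_assoc]
  tfae_finish
end

section
/- Let g ≥ 1 and let F₁,…,F_g be closed subspaces of a complex Hilbert space H, and let w₁,…,w_g be strictly positive real numbers with w₁ + ⋯ + w_g = 1. Let f ∈ H with f ≠ 0 and let λ ∈ ℂ with |λ| = 1. If ∑_{d=1}^g w_d P_{F_d} f = λ f, then f ∈ ⋂_{d=1}^g F_d and λ = 1. -/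
set_option linter.unusedSectionVars false

variable {H : Type*} [NormedAddCommGroup H] [InnerProductSpace ℂ H] [CompleteSpace H]

theorem proj_norm_le (S : Submodule ℂ H) (hS : IsClosed (S : Set H)) (f : H) :
    ‖proj S hS f‖ ≤ ‖f‖ := by
  haveI : CompleteSpace S := hS.completeSpace_coe
  exact S.norm_starProjection_apply_le f

theorem mem_of_proj_norm (S : Submodule ℂ H) (hS : IsClosed (S : Set H)) (f : H)
    (h : ‖proj S hS f‖ = ‖f‖) : f ∈ S := by
  haveI : CompleteSpace S := hS.completeSpace_coe
  exact (S.mem_iff_norm_starProjection f).2 h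

theorem proj_of_mem (S : Submodule ℂ H) (hS : IsClosed (S : Set H)) (f : H)
    (h : f ∈ S) : proj S hS f = f := by
  haveI : CompleteSpace S := hS.completeSpace_coe
  exact S.starProjection_eq_self_iff.2 h

/-- A convex combination of orthogonal projections with strictly positive
weights has no eigenvalue of modulus one other than `1`, and any corresponding eigenvector
lies in the intersection of the subspaces. -/
theorem eigenvector_of_convex_combination_projections
    {g : ℕ} (hg : 1 ≤ g) (F : Fin g → Submodule ℂ H)
    (hF : ∀ d, IsClosed ((F d : Set H)))
    (w : Fin g → ℝ) (hw : ∀ d, 0 < w d) (hw1 : ∑ d, w d = 1)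
    (f : H) (hf : f ≠ 0) (lam : ℂ) (hlam : ‖lam‖ = 1)
    (heig : (∑ d, (w d : ℂ) • proj (F d) (hF d)) f = lam • f) :
    f ∈ ⨅ d, F d ∧ lam = 1 := by
  have heq : ∑ d, (w d : ℂ) • proj (F d) (hF d) f = lam • f := by
    simpa using heig
  have hle : ∀ d ∈ Finset.univ, w d * ‖proj (F d) (hF d) f‖ ≤ w d * ‖f‖ := fun d _ =>
    mul_le_mul_of_nonneg_left (proj_norm_le _ _ _) (hw d).le
  have hsum : ∑ d, w d * ‖f‖ = ‖f‖ := by rw [← Finset.sum_mul, hw1, one_mul]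
  have hge : ‖f‖ ≤ ∑ d, w d * ‖proj (F d) (hF d) f‖ := by
    calc ‖f‖ = ‖∑ d, (w d : ℂ) • proj (F d) (hF d) f‖ := by
          rw [heq, norm_smul, hlam, one_mul]
      _ ≤ ∑ d, ‖(w d : ℂ) • proj (F d) (hF d) f‖ := norm_sum_le _ _
      _ = ∑ d, w d * ‖proj (F d) (hF d) f‖ := by
          refine Finset.sum_congr rfl fun d _ => ?_
          rw [norm_smul, Complex.norm_real, Real.norm_of_nonneg (hw d).le]
  have hall := (Finset.sum_eq_sum_iff_of_le hle).1
    (le_antisymm (Finset.sum_le_sum hle) (hsum.le.trans hge))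
  have hmem : ∀ d, f ∈ F d := fun d =>
    mem_of_proj_norm _ (hF d) f (mul_left_cancel₀ (hw d).ne' (hall d (Finset.mem_univ d)))
  refine ⟨(Submodule.mem_iInf _).2 hmem, ?_⟩
  have h1 : ∑ d, (w d : ℂ) • proj (F d) (hF d) f = (1 : ℂ) • f := by
    rw [Finset.sum_congr rfl fun d _ => by rw [proj_of_mem _ (hF d) f (hmem d)],
      ← Finset.sum_smul, ← Complex.ofReal_sum, hw1, Complex.ofReal_one]
  exact smul_left_injective ℂ hf (heq.symm.trans h1)
end
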